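/- arXiv:2510.07542 — 2 statements merged into one kernel-verified Lean document; each statement's English description precedes it below -/
import Mathlib

section
/- Let C²_{0,w}(ℝ^d) be the closure of C_c²(ℝ^d) in the norm ‖φ‖ = ‖φ‖_∞ + ‖(1+|x|)∇φ‖_∞ + ‖(1+|x|²)∇^{⊗2}φ‖_∞, and let D_{2,w}(μ,ν) = sup{|∫φ dμ − ∫φ dν| : φ ∈ C²_{0,w}(ℝ^d), ‖φ‖ ≤ 1} for finite positive measures μ,ν on ℝ^d. Then D_{2,w} is a complete metric on P(ℝ^d) that metrizes narrow convergence. -/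
open MeasureTheory Filter

noncomputable section

abbrev Ed (d : ℕ) := EuclideanSpace ℝ (Fin d)

/-- A test function for the weighted metric `D_{2,w}`: `φ ∈ C_c²(ℝ^d)` with
`‖φ‖_∞ + ‖(1+|x|)∇φ‖_∞ + ‖(1+|x|²)∇^{⊗2}φ‖_∞ ≤ 1`.  (By the paper's definition the
supremum over the closure `C²_{0,w}` of `C_c²` in this norm can equivalently be taken
over `C_c²` itself.) -/
def IsD2wTest (d : ℕ) (φ : Ed d → ℝ) : Prop :=
  ContDiff ℝ 2 φ ∧ HasCompactSupport φ ∧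
  ∃ A B C : ℝ, A + B + C ≤ 1 ∧
    (∀ x, |φ x| ≤ A) ∧
    (∀ x, (1 + ‖x‖) * ‖iteratedFDeriv ℝ 1 φ x‖ ≤ B) ∧
    (∀ x, (1 + ‖x‖ ^ 2) * ‖iteratedFDeriv ℝ 2 φ x‖ ≤ C)

/-- The weighted integral metric `D_{2,w}`. -/
noncomputable def D2w (d : ℕ) (μ ν : Measure (Ed d)) : ℝ :=
  sSup {r | ∃ φ : Ed d → ℝ, IsD2wTest d φ ∧ r = |∫ x, φ x ∂μ - ∫ x, φ x ∂ν|}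

namespace IsD2wTest

variable {d : ℕ} {φ : Ed d → ℝ}

theorem abs_le_one (h : IsD2wTest d φ) (x : Ed d) : |φ x| ≤ 1 := by
  obtain ⟨-, -, A, B, C, hABC, hA, hB, hC⟩ := h
  have hB0 : 0 ≤ B := le_trans (by positivity) (hB x)
  have hC0 : 0 ≤ C := le_trans (by positivity) (hC x)
  linarith [hA x]

theorem lipschitzWith (h : IsD2wTest d φ) : LipschitzWith 1 φ := by
  obtain ⟨hφ, -, A, B, C, hABC, hA, hB, hC⟩ := h
  refine lipschitzWith_of_nnnorm_fderiv_le (𝕜 := ℝ) (hφ.differentiable (by norm_num)) fun x => ?_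
  have hA0 : 0 ≤ A := le_trans (abs_nonneg _) (hA x)
  have hC0 : 0 ≤ C := le_trans (by positivity) (hC x)
  have hx := hB x
  rw [norm_iteratedFDeriv_one] at hx
  have : ‖fderiv ℝ φ x‖ ≤ 1 := by
    nlinarith [mul_nonneg (norm_nonneg x) (norm_nonneg (fderiv ℝ φ x))]
  exact_mod_cast this

theorem zero : IsD2wTest d (fun _ => 0) := by
  refine ⟨contDiff_const, HasCompactSupport.zero, 0, 0, 0, by norm_num, by simp, ?_, ?_⟩ <;>
    intro x <;> simp [← Pi.zero_def]

theorem neg (h : IsD2wTest d φ) : IsD2wTest d (fun x => -φ x) := by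
  obtain ⟨hφ, hs, A, B, C, hABC, hA, hB, hC⟩ := h
  refine ⟨hφ.neg, hs.comp_left neg_zero, A, B, C, hABC, by simpa using hA, ?_, ?_⟩ <;> intro x
  · simpa [← Pi.neg_def, iteratedFDeriv_neg_apply] using hB x
  · simpa [← Pi.neg_def, iteratedFDeriv_neg_apply] using hC x

/-- The weights make the test class stable under spatial dilation. -/
theorem comp_smul (h : IsD2wTest d φ) {a : ℝ} (ha0 : 0 < a) (ha1 : a ≤ 1) :
    IsD2wTest d (fun x => φ (a • x)) := by
  obtain ⟨hφ, hs, A, B, C, hABC, hA, hB, hC⟩ := h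
  refine ⟨hφ.comp (contDiff_const_smul a), hs.comp_smul ha0.ne', A, B, C, hABC,
    fun x => hA _, fun x => ?_, fun x => ?_⟩
  · rw [iteratedFDeriv_comp_const_smul a (hφ.of_le (by norm_num)), norm_smul, norm_pow,
      Real.norm_of_nonneg ha0.le, ← mul_assoc]
    refine le_trans ?_ (hB (a • x))
    gcongr
    rw [norm_smul, Real.norm_of_nonneg ha0.le]
    nlinarith [norm_nonneg x]
  · rw [iteratedFDeriv_comp_const_smul a hφ, norm_smul, norm_pow,
      Real.norm_of_nonneg ha0.le, ← mul_assoc]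
    refine le_trans ?_ (hC (a • x))
    gcongr
    rw [norm_smul, Real.norm_of_nonneg ha0.le]
    nlinarith [norm_nonneg x]

theorem exists_bound_weighted_iteratedFDeriv (hφ : ContDiff ℝ 2 φ) (hs : HasCompactSupport φ)
    {i : ℕ} (hi : i ≤ 2) {w : Ed d → ℝ} (hw : Continuous w) :
    ∃ M ≥ 0, ∀ x, w x * ‖iteratedFDeriv ℝ i φ x‖ ≤ M := by
  have hc : Continuous fun x => w x * ‖iteratedFDeriv ℝ i φ x‖ :=
    hw.mul (hφ.continuous_iteratedFDeriv (by exact_mod_cast hi)).norm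
  have hcs : HasCompactSupport fun x => w x * ‖iteratedFDeriv ℝ i φ x‖ :=
    HasCompactSupport.mul_left (f := w) (f' := fun x => ‖iteratedFDeriv ℝ i φ x‖)
      (hs.iteratedFDeriv i).norm
  obtain ⟨M, hM⟩ := hc.bounded_above_of_compact_support hcs
  exact ⟨|M|, abs_nonneg _, fun x => (le_abs_self _).trans ((hM x).trans (le_abs_self _))⟩

theorem norm_iteratedFDeriv_const_mul (hφ : ContDiff ℝ 2 φ) {i : ℕ} (hi : i ≤ 2) {c : ℝ}
    (hc : 0 ≤ c) (x : Ed d) :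
    ‖iteratedFDeriv ℝ i (fun x => c * φ x) x‖ = c * ‖iteratedFDeriv ℝ i φ x‖ := by
  have h : iteratedFDeriv ℝ i (fun x => c • φ x) x = c • iteratedFDeriv ℝ i φ x :=
    iteratedFDeriv_const_smul_apply' (𝕜 := ℝ) (a := c)
      (hφ.of_le (by exact_mod_cast hi)).contDiffAt
  simp only [smul_eq_mul] at h
  rw [h, norm_smul, Real.norm_of_nonneg hc]

theorem exists_mul (hφ : ContDiff ℝ 2 φ) (hs : HasCompactSupport φ) :
    ∃ c > 0, IsD2wTest d (fun x => c * φ x) := by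
  obtain ⟨A, hA0, hA⟩ := exists_bound_weighted_iteratedFDeriv hφ hs (Nat.zero_le 2)
    (continuous_const (y := (1 : ℝ)))
  obtain ⟨B, hB0, hB⟩ := exists_bound_weighted_iteratedFDeriv hφ hs one_le_two
    (w := fun x => 1 + ‖x‖) (by fun_prop)
  obtain ⟨C, hC0, hC⟩ := exists_bound_weighted_iteratedFDeriv hφ hs le_rfl
    (w := fun x => 1 + ‖x‖ ^ 2) (by fun_prop)
  obtain ⟨c, hc, hc1⟩ : ∃ c > 0, c * (A + B + C) ≤ 1 :=
    ⟨(A + B + C + 1)⁻¹, by positivity, inv_mul_le_one_of_le₀ (by linarith) (by positivity)⟩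
  refine ⟨c, hc, contDiff_const.mul hφ, hs.mul_left, c * A, c * B, c * C, by linarith,
    fun x => ?_, fun x => ?_, fun x => ?_⟩
  · rw [abs_mul, abs_of_pos hc]
    gcongr
    simpa using hA x
  · rw [norm_iteratedFDeriv_const_mul hφ one_le_two hc.le, mul_left_comm]
    gcongr
    exact hB x
  · rw [norm_iteratedFDeriv_const_mul hφ le_rfl hc.le, mul_left_comm]
    gcongr
    exact hC x

theorem integrable (h : IsD2wTest d φ) (μ : Measure (Ed d)) [IsFiniteMeasure μ] :
    Integrable φ μ :=
  h.1.continuous.integrable_of_hasCompactSupport h.2.1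

theorem abs_integral_le_one (h : IsD2wTest d φ) (μ : Measure (Ed d)) [IsProbabilityMeasure μ] :
    |∫ x, φ x ∂μ| ≤ 1 := by
  simpa using norm_integral_le_of_norm_le_const (μ := μ) (f := φ) (C := 1) (.of_forall h.abs_le_one)

end IsD2wTest

section Metric

variable {d : ℕ} (μ ν : Measure (Ed d))

theorem le_D2w [IsProbabilityMeasure μ] [IsProbabilityMeasure ν] {φ : Ed d → ℝ}
    (h : IsD2wTest d φ) : |∫ x, φ x ∂μ - ∫ x, φ x ∂ν| ≤ D2w d μ ν := by
  refine le_csSup ⟨2, ?_⟩ ⟨φ, h, rfl⟩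
  rintro r ⟨ψ, hψ, rfl⟩
  linarith [abs_sub (∫ x, ψ x ∂μ) (∫ x, ψ x ∂ν), hψ.abs_integral_le_one μ,
    hψ.abs_integral_le_one ν]

theorem D2w_le {r : ℝ}
    (h : ∀ φ, IsD2wTest d φ → |∫ x, φ x ∂μ - ∫ x, φ x ∂ν| ≤ r) : D2w d μ ν ≤ r := by
  refine csSup_le ⟨_, _, .zero, rfl⟩ ?_
  rintro r ⟨φ, hφ, rfl⟩
  exact h φ hφ

theorem D2w_nonneg : 0 ≤ D2w d μ ν := by
  refine Real.sSup_nonneg ?_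
  rintro r ⟨φ, hφ, rfl⟩
  exact abs_nonneg _

theorem D2w_self : D2w d μ μ = 0 :=
  le_antisymm (D2w_le μ μ fun φ _ => by simp) (D2w_nonneg μ μ)

theorem D2w_comm : D2w d μ ν = D2w d ν μ := by
  simp only [D2w, abs_sub_comm]

theorem D2w_triangle (η : Measure (Ed d)) [IsProbabilityMeasure μ] [IsProbabilityMeasure ν]
    [IsProbabilityMeasure η] : D2w d μ η ≤ D2w d μ ν + D2w d ν η :=
  D2w_le μ η fun _ hφ =>
    (abs_sub_le _ _ _).trans (add_le_add (le_D2w μ ν hφ) (le_D2w ν η hφ))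

end Metric

theorem BoundedContinuousFunction.integral_le_add_of_levyProkhorovEDist_lt
    {Ω : Type*} [MeasurableSpace Ω] [PseudoMetricSpace Ω] [OpensMeasurableSpace Ω]
    (μ ν : Measure Ω) [IsFiniteMeasure μ] [IsProbabilityMeasure ν] {ε : ℝ} (hε : 0 < ε)
    (h : levyProkhorovEDist μ ν < ENNReal.ofReal ε) (f : BoundedContinuousFunction Ω ℝ)
    (hf : ∀ x, 0 ≤ f x) (hL : LipschitzWith 1 f) :
    ∫ x, f x ∂μ ≤ ∫ x, f x ∂ν + ε * (1 + ‖f‖) := by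
  have hint : Integrable (fun x => f x + ε) ν := (f.integrable ν).add (integrable_const ε)
  have hanti : Antitone fun t : ℝ => ν.real {a | t ≤ f a + ε} := fun s t hst =>
    measureReal_mono fun a (ha : t ≤ f a + ε) => hst.trans ha
  have hanti' : Antitone fun t : ℝ => ν.real (Metric.thickening ε {a | t ≤ f a}) := fun s t hst =>
    measureReal_mono (Metric.thickening_subset_of_subset ε fun a (ha : t ≤ f a) => hst.trans ha)
  have hon (g : ℝ → ℝ) (hg : Antitone g) (b : ℝ) : IntegrableOn g (Set.Ioc 0 b) :=
    ((hg.antitoneOn (Set.Icc 0 b)).integrableOn_isCompact isCompact_Icc).mono_set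
      Set.Ioc_subset_Icc_self
  calc ∫ x, f x ∂μ
      ≤ (∫ t in Set.Ioc 0 ‖f‖, ν.real (Metric.thickening ε {a | t ≤ f a})) + ε * ‖f‖ :=
        f.integral_le_of_levyProkhorovEDist_lt μ ν hε h (.of_forall hf)
    _ ≤ (∫ t in Set.Ioc 0 (‖f‖ + ε), ν.real {a | t ≤ f a + ε}) + ε * ‖f‖ := by
        gcongr ?_ + _
        refine (setIntegral_mono (hon _ hanti' _) (hon _ hanti _) fun t => ?_).trans
          (setIntegral_mono_set (hon _ hanti _) (.of_forall fun t => measureReal_nonneg)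
            (Set.Ioc_subset_Ioc_right (by linarith)).eventuallyLE)
        refine measureReal_mono fun a ha => ?_
        obtain ⟨b, hb, hab⟩ := Metric.mem_thickening_iff.1 ha
        have h1 := hL.dist_le_mul a b
        rw [Real.dist_eq, NNReal.coe_one, one_mul] at h1
        have h2 : t ≤ f b := hb
        change t ≤ f a + ε
        linarith [neg_abs_le (f a - f b)]
    _ = (∫ x, (f x + ε) ∂ν) + ε * ‖f‖ := by
        rw [hint.integral_eq_integral_Ioc_meas_le (M := ‖f‖ + ε)]
        · exact .of_forall fun x => add_nonneg (hf x) hε.le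
        · exact .of_forall fun x => by simpa using f.apply_le_norm x
    _ = _ := by
        rw [integral_add (f.integrable ν) (integrable_const ε)]
        simp
        ring

theorem D2w_le_of_levyProkhorovEDist_lt {d : ℕ} (μ ν : Measure (Ed d)) [IsProbabilityMeasure μ]
    [IsProbabilityMeasure ν] {ε : ℝ} (hε : 0 < ε)
    (h : levyProkhorovEDist μ ν < ENNReal.ofReal ε) : D2w d μ ν ≤ 3 * ε := by
  have key (φ : Ed d → ℝ) (hφ : IsD2wTest d φ) : ∫ x, φ x ∂μ - ∫ x, φ x ∂ν ≤ 3 * ε := by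
    have hle (x : Ed d) := abs_le.1 (hφ.abs_le_one x)
    have hbound (x : Ed d) : ‖φ x + 1‖ ≤ 2 := by
      rw [Real.norm_eq_abs, abs_le]
      constructor <;> linarith [(hle x).1, (hle x).2]
    let f : BoundedContinuousFunction (Ed d) ℝ :=
      .ofNormedAddCommGroup (fun x => φ x + 1) (hφ.1.continuous.add continuous_const) 2 hbound
    have hfn : ‖f‖ ≤ 2 :=
      BoundedContinuousFunction.norm_ofNormedAddCommGroup_le _ (by norm_num) hbound
    have hfL : LipschitzWith 1 f := by
      simpa using! hφ.lipschitzWith.add (LipschitzWith.const (1 : ℝ))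
    have := f.integral_le_add_of_levyProkhorovEDist_lt μ ν hε h
      (fun x => by change 0 ≤ φ x + 1; linarith [(hle x).1]) hfL
    change ∫ x, (φ x + 1) ∂μ ≤ ∫ x, (φ x + 1) ∂ν + _ at this
    rw [integral_add (hφ.integrable μ) (integrable_const _),
      integral_add (hφ.integrable ν) (integrable_const _)] at this
    simp only [integral_const, probReal_univ, smul_eq_mul, mul_one] at this
    nlinarith
  refine D2w_le μ ν fun φ hφ => abs_le.2 ⟨?_, key φ hφ⟩
  have := key _ hφ.neg
  rw [integral_neg, integral_neg] at this
  linarith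

theorem tendsto_D2w_of_tendsto {d : ℕ} {ι : Type*} {L : Filter ι}
    {μ : ι → ProbabilityMeasure (Ed d)} {ν : ProbabilityMeasure (Ed d)} (h : Tendsto μ L (nhds ν)) :
    Tendsto (fun n => D2w d (μ n : Measure (Ed d)) (ν : Measure (Ed d))) L (nhds 0) := by
  have hLP := ((LevyProkhorov.probabilityMeasureHomeomorph (Ω := Ed d)).continuous.tendsto ν).comp h
  rw [EMetric.tendsto_nhds] at hLP
  refine Metric.tendsto_nhds.2 fun ε hε => ?_
  filter_upwards [hLP (ENNReal.ofReal (ε / 4)) (by positivity)] with n hn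
  have hn' : levyProkhorovEDist (μ n : Measure (Ed d)) ν < ENNReal.ofReal (ε / 4) := by
    simpa [LevyProkhorov.edist_probabilityMeasure_def] using! hn
  rw [Real.dist_eq, sub_zero, abs_of_nonneg (D2w_nonneg _ _)]
  linarith [D2w_le_of_levyProkhorovEDist_lt _ _ (by positivity) hn']

theorem exists_contDiff_hasCompactSupport_between {d : ℕ} {K G : Set (Ed d)} (hK : IsCompact K)
    (hG : IsOpen G) (hKG : K ⊆ G) :
    ∃ f : Ed d → ℝ, ContDiff ℝ 2 f ∧ HasCompactSupport f ∧ (∀ x, 0 ≤ f x) ∧ (∀ x, f x ≤ 1) ∧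
      (∀ x ∈ K, f x = 1) ∧ ∀ x ∉ G, f x = 0 := by
  obtain ⟨L, hL, hKL, hLG⟩ := exists_compact_between hK hG hKG
  obtain ⟨f, hf, hr, hsupp, h1⟩ := exists_contMDiff_support_eq_eq_one_iff (n := 2)
    (modelWithCornersSelf ℝ (Ed d)) isOpen_interior hK.isClosed hKL
  have hr' (x : Ed d) : f x ∈ Set.Icc 0 1 := hr ⟨x, rfl⟩
  refine ⟨f, hf.contDiff, .of_support_subset_isCompact hL (hsupp.trans_subset interior_subset),
    fun x => (hr' x).1, fun x => (hr' x).2, fun x hx => (h1 x).1 hx, fun x hx => ?_⟩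
  rw [← Function.notMem_support, hsupp]
  exact fun hx' => hx (hLG (interior_subset hx'))

theorem ofReal_integral_le_measure {α : Type*} [MeasurableSpace α] (μ : Measure α)
    [IsFiniteMeasure μ] {f : α → ℝ} (hf : Integrable f μ) (h1 : ∀ x, f x ≤ 1)
    {s : Set α} (hs : MeasurableSet s) (hfs : ∀ x ∉ s, f x = 0) :
    ENNReal.ofReal (∫ x, f x ∂μ) ≤ μ s := by
  rw [← ofReal_measureReal (measure_ne_top μ s), ← integral_indicator_one hs]
  refine ENNReal.ofReal_le_ofReal (integral_mono hf ((integrable_const 1).indicator hs) fun x => ?_)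
  by_cases hx : x ∈ s
  · simpa [hx] using h1 x
  · simp [hx, hfs x hx]

theorem measure_le_ofReal_integral {α : Type*} [MeasurableSpace α] (μ : Measure α)
    [IsFiniteMeasure μ] {f : α → ℝ} (hf : Integrable f μ) (h0 : ∀ x, 0 ≤ f x)
    {s : Set α} (hs : MeasurableSet s) (hfs : ∀ x ∈ s, f x = 1) :
    μ s ≤ ENNReal.ofReal (∫ x, f x ∂μ) := by
  rw [← ofReal_measureReal (measure_ne_top μ s), ← integral_indicator_one hs]
  refine ENNReal.ofReal_le_ofReal (integral_mono ((integrable_const 1).indicator hs) hf fun x => ?_)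
  by_cases hx : x ∈ s
  · simp [hx, hfs x hx]
  · simpa [hx] using h0 x

theorem tendsto_of_tendsto_D2w {d : ℕ} {μ : ℕ → ProbabilityMeasure (Ed d)}
    {ν : ProbabilityMeasure (Ed d)}
    (h : Tendsto (fun n => D2w d (μ n : Measure (Ed d)) (ν : Measure (Ed d))) atTop (nhds 0)) :
    Tendsto μ atTop (nhds ν) := by
  refine tendsto_of_forall_isOpen_le_liminf_nat' fun G hG => le_of_forall_lt fun r hr => ?_
  obtain ⟨K, hKG, hK, hrK⟩ := hG.exists_lt_isCompact hr
  obtain ⟨f, hf, hfs, h0, h1, hfK, hfG⟩ := exists_contDiff_hasCompactSupport_between hK hG hKG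
  obtain ⟨c, hc, hcf⟩ := IsD2wTest.exists_mul hf hfs
  have hint (η : ProbabilityMeasure (Ed d)) : Integrable f (η : Measure (Ed d)) :=
    hf.continuous.integrable_of_hasCompactSupport hfs
  have hlim : Tendsto (fun n => ∫ x, f x ∂(μ n : Measure (Ed d))) atTop
      (nhds (∫ x, f x ∂(ν : Measure (Ed d)))) := by
    rw [tendsto_iff_dist_tendsto_zero]
    refine squeeze_zero (fun _ => dist_nonneg) (fun n => ?_) (by simpa using h.const_mul c⁻¹)
    have := le_D2w (μ n : Measure (Ed d)) ν hcf
    rw [integral_const_mul, integral_const_mul, ← mul_sub, abs_mul, abs_of_pos hc] at this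
    rw [Real.dist_eq]
    exact (le_inv_mul_iff₀ hc).2 this
  calc r < (ν : Measure (Ed d)) K := hrK
    _ ≤ ENNReal.ofReal (∫ x, f x ∂(ν : Measure (Ed d))) :=
        measure_le_ofReal_integral _ (hint ν) h0 hK.measurableSet hfK
    _ = liminf (fun n => ENNReal.ofReal (∫ x, f x ∂(μ n : Measure (Ed d)))) atTop :=
        (ENNReal.tendsto_ofReal hlim).liminf_eq.symm
    _ ≤ liminf (fun n => (μ n : Measure (Ed d)) G) atTop :=
        liminf_le_liminf (.of_forall fun n =>
          ofReal_integral_le_measure _ (hint _) h1 hG.measurableSet hfG)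

theorem isTightMeasureSet_range_of_cauchy_D2w {d : ℕ} {μ : ℕ → ProbabilityMeasure (Ed d)}
    (h : ∀ ε > (0 : ℝ), ∃ N, ∀ m ≥ N, ∀ n ≥ N,
      D2w d (μ m : Measure (Ed d)) (μ n : Measure (Ed d)) < ε) :
    IsTightMeasureSet {((η : ProbabilityMeasure (Ed d)) : Measure (Ed d)) | η ∈ Set.range μ} := by
  have hsingle (n : ℕ) {ε : ENNReal} (hε : 0 < ε) :
      ∃ K, IsCompact K ∧ (μ n : Measure (Ed d)) Kᶜ ≤ ε := by
    obtain ⟨K, hK, hKε⟩ := isTightMeasureSet_iff_exists_isCompact_measure_compl_le.1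
      (isTightMeasureSet_singleton (μ := (μ n : Measure (Ed d)))) ε hε
    exact ⟨K, hK, hKε _ rfl⟩
  obtain ⟨χ, hχ, hχs, hχ0, hχ1, hχb, -⟩ := exists_contDiff_hasCompactSupport_between
    (isCompact_closedBall (0 : Ed d) 1) isOpen_univ (Set.subset_univ _)
  obtain ⟨c, hc, hcχ⟩ := IsD2wTest.exists_mul hχ hχs
  have htail {δ : ℝ} (hδ : 0 < δ) : ∃ N, ∃ K, IsCompact K ∧
      ∀ n ≥ N, (μ n : Measure (Ed d)) Kᶜ ≤ ENNReal.ofReal (2 * δ) := by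
    obtain ⟨N, hN⟩ := h (c * δ) (by positivity)
    obtain ⟨K₀, hK₀, hμK₀⟩ := hsingle N (ENNReal.ofReal_pos.2 hδ)
    obtain ⟨R, hR1, hR⟩ : ∃ R : ℝ, 1 ≤ R ∧ K₀ ⊆ Metric.closedBall 0 R := by
      obtain ⟨R, hR⟩ := hK₀.isBounded.subset_closedBall 0
      exact ⟨max 1 R, le_max_left _ _,
        hR.trans (Metric.closedBall_subset_closedBall (le_max_right _ _))⟩
    have hR0 : 0 < R := by linarith
    have htest := hcχ.comp_smul (inv_pos.2 hR0) (inv_le_one_of_one_le₀ hR1)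
    set g : Ed d → ℝ := fun x => χ (R⁻¹ • x) with hg
    have hgs : HasCompactSupport g := hχs.comp_smul (inv_ne_zero hR0.ne')
    have hgint (η : ProbabilityMeasure (Ed d)) : Integrable g (η : Measure (Ed d)) :=
      (hχ.continuous.comp (continuous_const_smul _)).integrable_of_hasCompactSupport hgs
    have hgK (x : Ed d) (hx : x ∈ K₀) : g x = 1 := by
      refine hχb _ ?_
      have := hR hx
      rw [mem_closedBall_zero_iff] at this ⊢
      rw [norm_smul, norm_inv, Real.norm_of_nonneg hR0.le]
      exact inv_mul_le_one_of_le₀ this hR0.le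
    refine ⟨N, tsupport g, hgs, fun n hn => ?_⟩
    have hD := (le_D2w (μ N : Measure (Ed d)) (μ n) htest).trans_lt (hN N le_rfl n hn)
    simp only [integral_const_mul] at hD
    rw [← mul_sub, abs_mul, abs_of_pos hc] at hD
    have hD' := (abs_lt.1 (lt_of_mul_lt_mul_left hD hc.le)).2
    have h1 := measure_le_ofReal_integral (μ N : Measure (Ed d)) (hgint _) (fun x => hχ0 _)
      hK₀.measurableSet hgK
    have h2 := ofReal_integral_le_measure (μ n : Measure (Ed d)) (hgint _)
      (fun x => hχ1 _) (isClosed_tsupport g).measurableSet fun x => image_eq_zero_of_notMem_tsupport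
    have hnn (η : ProbabilityMeasure (Ed d)) : 0 ≤ ∫ x, g x ∂(η : Measure (Ed d)) :=
      integral_nonneg fun x => hχ0 _
    rw [← ofReal_measureReal, ENNReal.ofReal_le_ofReal_iff (hnn _)] at h1
    rw [← ofReal_measureReal, ENNReal.ofReal_le_ofReal_iff measureReal_nonneg] at h2
    rw [← ofReal_measureReal, ENNReal.ofReal_le_ofReal_iff hδ.le,
      probReal_compl_eq_one_sub hK₀.measurableSet] at hμK₀
    rw [← ofReal_measureReal]
    refine ENNReal.ofReal_le_ofReal ?_
    rw [probReal_compl_eq_one_sub (isClosed_tsupport g).measurableSet]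
    linarith
  refine isTightMeasureSet_iff_exists_isCompact_measure_compl_le.2 fun ε hε => ?_
  obtain ⟨δ, hδ, hδε⟩ : ∃ δ : ℝ, 0 < δ ∧ ENNReal.ofReal (2 * δ) ≤ ε := by
    obtain ⟨r, hr0, hr⟩ := ENNReal.lt_iff_exists_nnreal_btwn.1 hε
    have hr0' : (0 : ℝ) < r := by exact_mod_cast hr0
    refine ⟨r / 2, by positivity, ?_⟩
    rw [mul_div_cancel₀ _ two_ne_zero, ENNReal.ofReal_coe_nnreal]
    exact hr.le
  obtain ⟨N, K, hK, hμK⟩ := htail hδ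
  choose K' hK' hμK' using fun n => hsingle n hε
  refine ⟨K ∪ ⋃ i ∈ Set.Iio N, K' i,
    hK.union ((Set.finite_Iio N).isCompact_biUnion fun i _ => hK' i), ?_⟩
  rintro _ ⟨_, ⟨n, rfl⟩, rfl⟩
  rcases lt_or_ge n N with hn | hn
  · refine (measure_mono (Set.compl_subset_compl.2 ?_)).trans (hμK' n)
    exact (Set.subset_biUnion_of_mem (u := K') (Set.mem_Iio.2 hn)).trans Set.subset_union_right
  · exact (measure_mono (Set.compl_subset_compl.2 Set.subset_union_left)).trans
      ((hμK n hn).trans hδε)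

theorem exists_tendsto_D2w_of_cauchy {d : ℕ} {μ : ℕ → ProbabilityMeasure (Ed d)}
    (h : ∀ ε > (0 : ℝ), ∃ N, ∀ m ≥ N, ∀ n ≥ N,
      D2w d (μ m : Measure (Ed d)) (μ n : Measure (Ed d)) < ε) :
    ∃ ν : ProbabilityMeasure (Ed d),
      Tendsto (fun n => D2w d (μ n : Measure (Ed d)) (ν : Measure (Ed d))) atTop (nhds 0) := by
  have hcomp := isCompact_closure_of_isTightMeasureSet (isTightMeasureSet_range_of_cauchy_D2w h)
  obtain ⟨ν, -, s, hs, hν⟩ := hcomp.tendsto_subseq fun n => subset_closure (Set.mem_range_self n)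
  refine ⟨ν, Metric.tendsto_atTop.2 fun ε hε => ?_⟩
  obtain ⟨N, hN⟩ := h (ε / 2) (by positivity)
  obtain ⟨M, hM⟩ := Metric.tendsto_atTop.1 (tendsto_D2w_of_tendsto hν) (ε / 2) (by positivity)
  refine ⟨N, fun n hn => ?_⟩
  have h1 := hM (max M N) (le_max_left _ _)
  have h2 := hN n hn (s (max M N)) ((le_max_right _ _).trans (hs.id_le _))
  rw [Real.dist_eq, sub_zero, abs_of_nonneg (D2w_nonneg _ _)] at h1 ⊢
  have h3 := D2w_triangle (μ n : Measure (Ed d)) (μ (s (max M N))) ν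
  simp only [Function.comp_apply] at h1
  linarith

/-- `D_{2,w}` is a complete metric on `P(ℝ^d)` metrizing the narrow
topology. -/
theorem stmt6 (d : ℕ) :
    (∀ μ ν : ProbabilityMeasure (Ed d),
      D2w d μ ν = D2w d ν μ) ∧
    (∀ μ : ProbabilityMeasure (Ed d), D2w d μ μ = 0) ∧
    (∀ μ ν η : ProbabilityMeasure (Ed d),
      D2w d (μ : Measure (Ed d)) η ≤ D2w d (μ : Measure (Ed d)) ν + D2w d (ν : Measure (Ed d)) η) ∧
    (∀ μ ν : ProbabilityMeasure (Ed d),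
      0 ≤ D2w d (μ : Measure (Ed d)) ν ∧
      (D2w d (μ : Measure (Ed d)) ν = 0 → μ = ν)) ∧
    (∀ (μ : ℕ → ProbabilityMeasure (Ed d)) (ν : ProbabilityMeasure (Ed d)),
      Tendsto μ atTop (nhds ν) ↔
        Tendsto (fun n => D2w d (μ n : Measure (Ed d)) (ν : Measure (Ed d)))
          atTop (nhds 0)) ∧
    (∀ μ : ℕ → ProbabilityMeasure (Ed d),
      (∀ ε > (0:ℝ), ∃ N, ∀ m ≥ N, ∀ n ≥ N,
        D2w d (μ m : Measure (Ed d)) (μ n : Measure (Ed d)) < ε) →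
      ∃ ν : ProbabilityMeasure (Ed d),
        Tendsto (fun n => D2w d (μ n : Measure (Ed d)) (ν : Measure (Ed d)))
          atTop (nhds 0)) := by
  refine ⟨fun μ ν => D2w_comm _ _, fun μ => D2w_self _, fun μ ν η => D2w_triangle _ _ _,
    fun μ ν => ⟨D2w_nonneg _ _, fun h => ?_⟩,
    fun μ ν => ⟨tendsto_D2w_of_tendsto, tendsto_of_tendsto_D2w⟩,
    fun μ h => exists_tendsto_D2w_of_cauchy h⟩
  refine tendsto_nhds_unique (tendsto_const_nhds (f := (atTop : Filter ℕ))) ?_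
  refine tendsto_of_tendsto_D2w ?_
  simp only [h]
  exact tendsto_const_nhds
end
end

section
/- Let Λ be a probability measure on C([0,T],P(ℝ^d)) concentrated on KFP(b,a) with ∫∫_0^T∫ [|b(t,x,μ_t)|/(1+|x|) + |a(t,x,μ_t)|/(1+|x|²)] dμ_t(x) dt dΛ(μ) < ∞. Then the curve of random measures M_t := (e_t)_#Λ ∈ P(P(ℝ^d)) satisfies ∫_0^T∫∫ [|b(t,x,μ)|/(1+|x|) + |a(t,x,μ)|/(1+|x|²)] dμ dM_t dt < ∞ and solves ∂_t M_t = K*_{b_t,a_t} M_t, i.e., for all cylinder functions F = Ψ∘L_Φ ∈ Cyl_c^{1,2}(P(ℝ^d)) and ξ ∈ C_c^1(0,T): ∫_0^T ξ'(t)∫F(μ) dM_t(μ) dt = −∫_0^T ξ(t)∫∫ K_{b_t,a_t}F(x,μ) dμ(x) dM_t(μ) dt. -/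
open MeasureTheory Set
open scoped ENNReal RealInnerProductSpace

noncomputable section

/-- `P(ℝ^d)` with the narrow topology. -/
abbrev Pm (d : ℕ) := ProbabilityMeasure (Ed d)

instance (d : ℕ) : MeasurableSpace (Pm d) := borel _

/-- `C([0,T],P(ℝ^d))` with the compact-open topology. -/
abbrev CurveSp (T : ℝ) (d : ℕ) := C(Set.Icc (0:ℝ) T, Pm d)

instance (T : ℝ) (d : ℕ) : MeasurableSpace (CurveSp T d) := borel _

/-- `ξ ∈ C_c^1((0,T))`. -/
def IsTestXi (T : ℝ) (ξ : ℝ → ℝ) : Prop :=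
  ContDiff ℝ 1 ξ ∧ HasCompactSupport ξ ∧ Function.support ξ ⊆ Set.Ioo 0 T

/-- `φ ∈ C_c^2(ℝ^d)`. -/
def IsTestPhi {d : ℕ} (φ : Ed d → ℝ) : Prop :=
  ContDiff ℝ 2 φ ∧ HasCompactSupport φ

/-- `L^μ_{b_t,a_t}φ(x)`. -/
def Lop {d : ℕ} (b : ℝ → Ed d → Pm d → Ed d)
    (a : ℝ → Ed d → Pm d → (Ed d →L[ℝ] Ed d))
    (μ : Pm d) (t : ℝ) (φ : Ed d → ℝ) (x : Ed d) : ℝ :=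
  ⟪b t x μ, gradient φ x⟫ +
    (1/2) * LinearMap.trace ℝ (Ed d) ((a t x μ ∘L fderiv ℝ (gradient φ) x).toLinearMap)

/-- `L_Φ(μ) = (∫φ_1 dμ, …, ∫φ_k dμ)`. -/
def LPhi {d k : ℕ} (Φ : Fin k → Ed d → ℝ) (μ : Pm d) : Fin k → ℝ :=
  fun i => ∫ x, Φ i x ∂(μ : Measure (Ed d))

/-- The operator `K_{b_t,a_t}` on the cylinder function `F = Ψ ∘ L_Φ`. -/
def Kba {d k : ℕ} (b : ℝ → Ed d → Pm d → Ed d)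
    (a : ℝ → Ed d → Pm d → (Ed d →L[ℝ] Ed d)) (t : ℝ)
    (Ψ : (Fin k → ℝ) → ℝ) (Φ : Fin k → Ed d → ℝ)
    (x : Ed d) (μ : Pm d) : ℝ :=
  ∑ i, fderiv ℝ Ψ (LPhi Φ μ) (Pi.single i 1) * Lop b a μ t (Φ i) x

/-- The weighted integrand `|b|/(1+|x|) + |a|/(1+|x|²)`. -/
def wInt {d : ℕ} (b : ℝ → Ed d → Pm d → Ed d)
    (a : ℝ → Ed d → Pm d → (Ed d →L[ℝ] Ed d)) (t : ℝ) (x : Ed d) (μ : Pm d) : ℝ :=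
  ‖b t x μ‖ / (1 + ‖x‖) + ‖a t x μ‖ / (1 + ‖x‖ ^ 2)

/-- `c ∈ KFP(b,a)` for a continuous curve `c : [0,T] → P(ℝ^d)`: weighted integrability
and the distributional Kolmogorov–Fokker–Planck equation. -/
def KFPmem {T : ℝ} {d : ℕ} (hT : 0 ≤ T) (b : ℝ → Ed d → Pm d → Ed d)
    (a : ℝ → Ed d → Pm d → (Ed d →L[ℝ] Ed d)) (c : CurveSp T d) : Prop :=
  (∫⁻ t in Set.Icc (0:ℝ) T, ∫⁻ x,
      ENNReal.ofReal (wInt b a t x (c (Set.projIcc 0 T hT t)))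
      ∂(c (Set.projIcc 0 T hT t) : Measure (Ed d)) ∂volume) < ∞ ∧
  ∀ ξ φ, IsTestXi T ξ → IsTestPhi (d := d) φ →
    ∫ t in (0:ℝ)..T, deriv ξ t *
        ∫ x, φ x ∂(c (Set.projIcc 0 T hT t) : Measure (Ed d)) =
      - ∫ t in (0:ℝ)..T, ξ t *
          ∫ x, Lop b a (c (Set.projIcc 0 T hT t)) t φ x
            ∂(c (Set.projIcc 0 T hT t) : Measure (Ed d))

/-- The composition of a Lipschitz function with finitely many absolutely continuous components
is absolutely continuous. -/
lemma LipschitzWith.absolutelyContinuousOnInterval_comp_pi {k : ℕ} {Ψ : (Fin k → ℝ) → ℝ}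
    {K : NNReal} (hΨ : LipschitzWith K Ψ) {G : ℝ → Fin k → ℝ} {p q : ℝ}
    (hG : ∀ i, AbsolutelyContinuousOnInterval (fun t => G t i) p q) :
    AbsolutelyContinuousOnInterval (fun t => Ψ (G t)) p q := by
  have hsum := (tendsto_finsetSum Finset.univ fun i _ => hG i).const_mul (K : ℝ)
  simp only [Finset.sum_const_zero, mul_zero] at hsum
  refine squeeze_zero (fun E => Finset.sum_nonneg fun _ _ => dist_nonneg) (fun E => ?_) hsum
  rw [Finset.sum_comm, Finset.mul_sum]
  refine Finset.sum_le_sum fun j _ => (hΨ.dist_le_mul _ _).trans ?_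
  refine mul_le_mul_of_nonneg_left ?_ K.coe_nonneg
  refine (dist_pi_le_iff (Finset.sum_nonneg fun _ _ => dist_nonneg)).2 fun i => ?_
  exact Finset.single_le_sum (f := fun i => dist (G (E.2 j).1 i) (G (E.2 j).2 i))
    (fun _ _ => dist_nonneg) (Finset.mem_univ i)

lemma IsTestXi.eq_zero {T : ℝ} {ξ : ℝ → ℝ} (hξ : IsTestXi T ξ) {t : ℝ}
    (ht : t ∉ Ioo 0 T) : ξ t = 0 := by
  by_contra h
  exact ht (hξ.2.2 h)

/-- Integration by parts of a test function against an absolutely continuous function. -/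
lemma IsTestXi.integral_deriv_mul {T : ℝ} {ξ : ℝ → ℝ} (hξ : IsTestXi T ξ) {G G' : ℝ → ℝ}
    (hG : AbsolutelyContinuousOnInterval G 0 T)
    (hG' : ∀ᵐ t, t ∈ uIcc 0 T → HasDerivAt G (G' t) t) :
    ∫ t in (0:ℝ)..T, deriv ξ t * G t = - ∫ t in (0:ℝ)..T, ξ t * G' t := by
  have hac : AbsolutelyContinuousOnInterval ξ 0 T :=
    hξ.1.contDiffOn.absolutelyContinuousOnInterval
  have h := hac.integral_mul_deriv_eq_deriv_mul hG
  rw [hξ.eq_zero (t := 0) (by simp), hξ.eq_zero (t := T) (by simp)] at h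
  have h2 : ∫ t in (0:ℝ)..T, ξ t * G' t = ∫ t in (0:ℝ)..T, ξ t * deriv G t := by
    refine intervalIntegral.integral_congr_ae ?_
    filter_upwards [hG'] with t ht htT
    rw [(ht (uIoc_subset_uIcc htT)).deriv]
  rw [h2, h]
  ring

/-- The primitive of a smooth mean-zero function supported in `(0,T)` is a test function. -/
lemma isTestXi_primitive {T : ℝ} {ψ : ℝ → ℝ} (hψ : Continuous ψ)
    (hsupp : Function.support ψ ⊆ Ioo 0 T) (hmean : ∫ t, ψ t = 0) :
    IsTestXi T (fun t => ∫ s in (0:ℝ)..t, ψ s) ∧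
      deriv (fun t => ∫ s in (0:ℝ)..t, ψ s) = ψ := by
  have hd : ∀ t, HasDerivAt (fun t => ∫ s in (0:ℝ)..t, ψ s) (ψ t) t := fun t =>
    intervalIntegral.integral_hasDerivAt_right (hψ.intervalIntegrable _ _)
      (hψ.stronglyMeasurableAtFilter _ _) hψ.continuousAt
  have hderiv : deriv (fun t => ∫ s in (0:ℝ)..t, ψ s) = ψ := funext fun t => (hd t).deriv
  have hsub : Function.support (fun t => ∫ s in (0:ℝ)..t, ψ s) ⊆ Ioo 0 T := by
    intro t ht
    by_contra hcon
    refine ht ?_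
    rcases le_or_gt t 0 with h0 | h0
    · refine intervalIntegral.integral_zero_ae (Filter.Eventually.of_forall fun s hs => ?_)
      by_contra hs0
      rw [uIoc_of_ge h0] at hs
      exact absurd (hsupp hs0).1 (not_lt.2 hs.2)
    · have hT : T ≤ t := by
        by_contra h
        exact hcon ⟨h0, not_le.1 h⟩
      change ∫ s in (0:ℝ)..t, ψ s = 0
      rw [intervalIntegral.integral_eq_integral_of_support_subset, hmean]
      exact hsupp.trans fun s hs => ⟨hs.1, hs.2.le.trans hT⟩
  refine ⟨⟨?_, ?_, hsub⟩, hderiv⟩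
  · rw [contDiff_one_iff_deriv]
    exact ⟨fun t => (hd t).differentiableAt, by rw [hderiv]; exact hψ⟩
  · exact HasCompactSupport.of_support_subset_isCompact isCompact_Icc
      (hsub.trans Ioo_subset_Icc_self)

/-- A function with integrable weak derivative `h` agrees a.e. with a primitive of `h`. -/
lemma exists_ae_eq_const_add_integral {T : ℝ} (hT : 0 < T) {g h : ℝ → ℝ}
    (hg : IntervalIntegrable g volume 0 T) (hh : IntervalIntegrable h volume 0 T)
    (hweak : ∀ ξ, IsTestXi T ξ →
      ∫ t in (0:ℝ)..T, deriv ξ t * g t = - ∫ t in (0:ℝ)..T, ξ t * h t) :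
    ∃ C : ℝ, ∀ᵐ t, t ∈ Ioo 0 T → g t = C + ∫ s in (0:ℝ)..t, h s := by
  set H : ℝ → ℝ := fun t => ∫ s in (0:ℝ)..t, h s with hH
  have hHac : AbsolutelyContinuousOnInterval H 0 T :=
    hh.absolutelyContinuousOnInterval_intervalIntegral (by simp)
  have hHd : ∀ᵐ t, t ∈ uIcc 0 T → HasDerivAt H (h t) t := by
    filter_upwards [hh.ae_hasDerivAt_integral] with t ht htT
    exact ht htT 0 (by simp)
  have hHi : IntervalIntegrable H volume 0 T := hHac.continuousOn.intervalIntegrable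
  have hu : IntervalIntegrable (fun t => g t - H t) volume 0 T := hg.sub hHi
  have key : ∀ ξ, IsTestXi T ξ → ∫ t in (0:ℝ)..T, deriv ξ t * (g t - H t) = 0 := by
    intro ξ hξ
    have hc : ContinuousOn (deriv ξ) (uIcc 0 T) := (hξ.1.continuous_deriv le_rfl).continuousOn
    simp_rw [mul_sub]
    rw [intervalIntegral.integral_sub (hg.continuousOn_mul hc) (hHi.continuousOn_mul hc),
      hweak ξ hξ, hξ.integral_deriv_mul hHac hHd, sub_self]
  let β : ContDiffBump (T / 2) := ⟨T / 8, T / 4, by positivity, by linarith⟩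
  let η₀ : ℝ → ℝ := β.normed volume
  have hη₀c : Continuous η₀ := β.continuous_normed
  have hη₀s : Function.support η₀ ⊆ Ioo 0 T := by
    rw [β.support_normed_eq, Real.ball_eq_Ioo]
    refine Ioo_subset_Ioo ?_ ?_ <;> simp only [β] <;> linarith
  have hη₀i : ∫ t, η₀ t = 1 := β.integral_normed
  set C := ∫ t in (0:ℝ)..T, η₀ t * (g t - H t) with hC
  refine ⟨C, ?_⟩
  have hloc : LocallyIntegrableOn (fun t => g t - H t - C) (Ioo 0 T) := by
    refine IntegrableOn.locallyIntegrableOn ?_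
    have := (hu.sub (intervalIntegrable_const (c := C)))
    exact ((intervalIntegrable_iff_integrableOn_Ioo_of_le hT.le).1 this)
  have hae := isOpen_Ioo.ae_eq_zero_of_integral_contDiff_smul_eq_zero hloc ?_
  · filter_upwards [hae] with t ht htT
    linarith [ht htT]
  intro η hη hηc hηs
  have hηs' : Function.support η ⊆ Ioo 0 T := (subset_tsupport η).trans hηs
  have hηi : Integrable η := hη.continuous.integrable_of_hasCompactSupport hηc
  have hη₀int : Integrable η₀ := hη₀c.integrable_of_hasCompactSupport β.hasCompactSupport_normed
  set m := ∫ t, η t with hm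
  obtain ⟨hξ, hξd⟩ := isTestXi_primitive (T := T) (ψ := fun t => η t - m * η₀ t)
    (hη.continuous.sub (hη₀c.const_mul m))
    (by
      intro t ht
      by_contra hcon
      have h1 : η t = 0 := by by_contra h; exact hcon (hηs' h)
      have h2 : η₀ t = 0 := by by_contra h; exact hcon (hη₀s h)
      exact ht (by simp [h1, h2]))
    (by
      rw [integral_sub hηi (hη₀int.const_mul m), integral_const_mul, hη₀i, ← hm]
      ring)
  have h0 := key _ hξ
  rw [hξd] at h0
  have hi1 : IntervalIntegrable (fun t => η t * (g t - H t)) volume 0 T :=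
    hu.continuousOn_mul hη.continuous.continuousOn
  have hi2 : IntervalIntegrable (fun t => η₀ t * (g t - H t)) volume 0 T :=
    hu.continuousOn_mul hη₀c.continuousOn
  have h1 : ∫ t in (0:ℝ)..T, (η t - m * η₀ t) * (g t - H t) =
      (∫ t in (0:ℝ)..T, η t * (g t - H t)) - m * C := by
    rw [hC, ← intervalIntegral.integral_const_mul, ← intervalIntegral.integral_sub hi1
      (hi2.const_mul m)]
    refine intervalIntegral.integral_congr fun t _ => ?_
    ring
  have hm' : ∫ t in (0:ℝ)..T, η t = m :=
    intervalIntegral.integral_eq_integral_of_support_subset (hηs'.trans Ioo_subset_Ioc_self)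
  have h2 : ∫ t, η t • (g t - H t - C) = ∫ t in (0:ℝ)..T, η t * (g t - H t - C) := by
    refine (intervalIntegral.integral_eq_integral_of_support_subset ?_).symm
    refine Function.support_mul_subset_left _ _ |>.trans ?_
    exact hηs'.trans Ioo_subset_Ioc_self
  rw [h2]
  simp_rw [mul_sub _ _ C]
  rw [intervalIntegral.integral_sub hi1 ((hη.continuous.intervalIntegrable _ _).mul_const C),
    intervalIntegral.integral_mul_const, hm', ← h1, h0]

/-- Chain rule for weak derivatives on an interval. -/
lemma weak_chain_rule {T : ℝ} (hT : 0 ≤ T) {k : ℕ} {Ψ : (Fin k → ℝ) → ℝ}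
    (hΨ : ContDiff ℝ 1 Ψ) (hΨc : HasCompactSupport Ψ) {g h : ℝ → Fin k → ℝ}
    (hg : ∀ i, IntervalIntegrable (fun t => g t i) volume 0 T)
    (hh : ∀ i, IntervalIntegrable (fun t => h t i) volume 0 T)
    (hweak : ∀ i ξ, IsTestXi T ξ →
      ∫ t in (0:ℝ)..T, deriv ξ t * g t i = - ∫ t in (0:ℝ)..T, ξ t * h t i)
    {ξ : ℝ → ℝ} (hξ : IsTestXi T ξ) :
    ∫ t in (0:ℝ)..T, deriv ξ t * Ψ (g t) =
      - ∫ t in (0:ℝ)..T, ξ t * ∑ i, fderiv ℝ Ψ (g t) (Pi.single i 1) * h t i := by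
  rcases hT.eq_or_lt with rfl | hT
  · simp
  choose C hC using fun i => exists_ae_eq_const_add_integral hT (hg i) (hh i) (hweak i)
  set G : ℝ → Fin k → ℝ := fun t i => C i + ∫ s in (0:ℝ)..t, h s i with hG
  have hgG : ∀ᵐ t, t ∈ uIoc 0 T → g t = G t := by
    have hne : ∀ᵐ t : ℝ, t ≠ T := by simp [ae_iff, measure_singleton]
    filter_upwards [ae_all_iff.2 hC, hne] with t ht htT hmem
    rw [uIoc_of_le hT.le] at hmem
    exact funext fun i => ht i ⟨hmem.1, lt_of_le_of_ne hmem.2 htT⟩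
  obtain ⟨K, hK⟩ := hΨ.lipschitzWith_of_hasCompactSupport hΨc one_ne_zero
  have hac : AbsolutelyContinuousOnInterval (fun t => Ψ (G t)) 0 T := by
    refine hK.absolutelyContinuousOnInterval_comp_pi fun i => ?_
    have hconst : AbsolutelyContinuousOnInterval (fun _ : ℝ => C i) 0 T :=
      (LipschitzWith.const (C i)).lipschitzOnWith.absolutelyContinuousOnInterval
    exact hconst.add ((hh i).absolutelyContinuousOnInterval_intervalIntegral (by simp))
  have hderiv : ∀ᵐ t, t ∈ uIcc 0 T → HasDerivAt (fun t => Ψ (G t))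
      (∑ i, fderiv ℝ Ψ (G t) (Pi.single i 1) * h t i) t := by
    filter_upwards [ae_all_iff.2 fun i => (hh i).ae_hasDerivAt_integral] with t ht htT
    have h1 : HasDerivAt G (h t) t :=
      hasDerivAt_pi.2 fun i => (ht i htT 0 (by simp)).const_add (C i)
    have h2 := ((hΨ.differentiable one_ne_zero) (G t)).hasFDerivAt.comp_hasDerivAt t h1
    refine h2.congr_deriv ?_
    have h3 := congrArg (fderiv ℝ Ψ (G t)) (pi_eq_sum_univ' (h t))
    rw [h3, map_sum]
    refine Finset.sum_congr rfl fun i _ => ?_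
    rw [map_smul, smul_eq_mul, mul_comm]
  have e1 : ∫ t in (0:ℝ)..T, deriv ξ t * Ψ (g t) = ∫ t in (0:ℝ)..T, deriv ξ t * Ψ (G t) := by
    refine intervalIntegral.integral_congr_ae ?_
    filter_upwards [hgG] with t ht hmem
    rw [ht hmem]
  have e2 : ∫ t in (0:ℝ)..T, ξ t * ∑ i, fderiv ℝ Ψ (g t) (Pi.single i 1) * h t i =
      ∫ t in (0:ℝ)..T, ξ t * ∑ i, fderiv ℝ Ψ (G t) (Pi.single i 1) * h t i := by
    refine intervalIntegral.integral_congr_ae ?_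
    filter_upwards [hgG] with t ht hmem
    rw [ht hmem]
  rw [e1, e2, hξ.integral_deriv_mul hac hderiv]

instance (d : ℕ) : BorelSpace (Pm d) := ⟨rfl⟩

instance (T : ℝ) (d : ℕ) : BorelSpace (CurveSp T d) := ⟨rfl⟩

/-- For the narrow topology on `P(ℝ^d)`, the inclusion into measures is Borel measurable. -/
lemma measurable_toMeasure_Pm (d : ℕ) : Measurable fun μ : Pm d => (μ : Measure (Ed d)) := by
  refine Measurable.measure_of_isPiSystem_of_isProbabilityMeasure
    (BorelSpace.measurable_eq (α := Ed d)) isPiSystem_isOpen fun G hG => ?_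
  refine LowerSemicontinuous.measurable (lowerSemicontinuous_iff_le_liminf.2 fun μ => ?_)
  exact ProbabilityMeasure.le_liminf_measure_open_of_tendsto Filter.tendsto_id hG

/-- The Markov kernel `(t, μ) ↦ μ`. -/
def kernelPm (d : ℕ) : ProbabilityTheory.Kernel (ℝ × Pm d) (Ed d) :=
  ⟨fun p => (p.2 : Measure (Ed d)), (measurable_toMeasure_Pm d).comp measurable_snd⟩

instance (d : ℕ) : ProbabilityTheory.IsMarkovKernel (kernelPm d) :=
  ⟨fun p => inferInstanceAs (IsProbabilityMeasure (p.2 : Measure (Ed d)))⟩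

lemma measurable_lintegral_Pm {d : ℕ} {f : ℝ × Ed d × Pm d → ℝ≥0∞} (hf : Measurable f) :
    Measurable fun p : ℝ × Pm d => ∫⁻ x, f (p.1, x, p.2) ∂(p.2 : Measure (Ed d)) :=
  Measurable.lintegral_kernel_prod_right (κ := kernelPm d)
    (f := fun p x => f (p.1, x, p.2)) (hf.comp (by fun_prop))

lemma measurable_integral_Pm {d : ℕ} {f : ℝ × Ed d × Pm d → ℝ} (hf : Measurable f) :
    Measurable fun p : ℝ × Pm d => ∫ x, f (p.1, x, p.2) ∂(p.2 : Measure (Ed d)) :=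
  (StronglyMeasurable.integral_kernel_prod_right (κ := kernelPm d)
    (f := fun p x => f (p.1, x, p.2))
    (Measurable.stronglyMeasurable (hf.comp (by fun_prop)))).measurable

lemma measurable_eval {T : ℝ} {d : ℕ} (hT : 0 ≤ T) :
    Measurable fun p : ℝ × CurveSp T d => p.2 (projIcc 0 T hT p.1) :=
  measurable_uncurry_of_continuous_of_measurable
    (u := fun (t : ℝ) (c : CurveSp T d) => c (projIcc 0 T hT t))
    (fun c => c.continuous.comp continuous_projIcc)
    (fun t => (continuous_eval_const (projIcc 0 T hT t)).measurable)

lemma IsTestPhi.contDiff_gradient {d : ℕ} {φ : Ed d → ℝ} (hφ : IsTestPhi φ) :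
    ContDiff ℝ 1 (gradient φ) :=
  (InnerProductSpace.toDual ℝ (Ed d)).symm.contDiff.comp
    (hφ.1.fderiv_right (m := 1) (by norm_num))

lemma IsTestPhi.hasCompactSupport_gradient {d : ℕ} {φ : Ed d → ℝ} (hφ : IsTestPhi φ) :
    HasCompactSupport (gradient φ) :=
  (hφ.2.fderiv (𝕜 := ℝ)).comp_left (g := (InnerProductSpace.toDual ℝ (Ed d)).symm) (map_zero _)

/-- The bilinear form `(A, B) ↦ tr (A ∘ B)` is bounded. -/
lemma exists_abs_trace_comp_le (d : ℕ) : ∃ K : ℝ, 0 ≤ K ∧ ∀ A B : Ed d →L[ℝ] Ed d,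
    |LinearMap.trace ℝ (Ed d) (A ∘L B).toLinearMap| ≤ K * (‖A‖ * ‖B‖) := by
  let τ : (Ed d →L[ℝ] Ed d) →L[ℝ] ℝ := LinearMap.toContinuousLinearMap
    (LinearMap.trace ℝ (Ed d) ∘ₗ ContinuousLinearMap.coeLM ℝ)
  refine ⟨‖τ‖, τ.opNorm_nonneg, fun A B => ?_⟩
  have h : |LinearMap.trace ℝ (Ed d) (A ∘L B).toLinearMap| = ‖τ (A ∘L B)‖ := rfl
  rw [h]
  exact (τ.le_opNorm _).trans
    (mul_le_mul_of_nonneg_left (A.opNorm_comp_le B) τ.opNorm_nonneg)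

lemma continuous_trace_comp (d : ℕ) : Continuous fun p : (Ed d →L[ℝ] Ed d) × (Ed d →L[ℝ] Ed d) =>
    LinearMap.trace ℝ (Ed d) (p.1 ∘L p.2).toLinearMap := by
  let τ : (Ed d →L[ℝ] Ed d) →L[ℝ] ℝ := LinearMap.toContinuousLinearMap
    (LinearMap.trace ℝ (Ed d) ∘ₗ ContinuousLinearMap.coeLM ℝ)
  exact τ.continuous.comp (continuous_fst.clm_comp continuous_snd)

lemma measurable_Lop {d : ℕ} {b : ℝ → Ed d → Pm d → Ed d}
    {a : ℝ → Ed d → Pm d → (Ed d →L[ℝ] Ed d)}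
    (hb : Measurable fun p : ℝ × Ed d × Pm d => b p.1 p.2.1 p.2.2)
    (ha : Measurable fun p : ℝ × Ed d × Pm d => a p.1 p.2.1 p.2.2)
    {φ : Ed d → ℝ} (hφ : IsTestPhi φ) :
    Measurable fun p : ℝ × Ed d × Pm d => Lop b a p.2.2 p.1 φ p.2.1 := by
  have : ProperSpace (Ed d →L[ℝ] Ed d) := FiniteDimensional.proper_real _
  have h1 : Measurable fun p : ℝ × Ed d × Pm d => gradient φ p.2.1 :=
    hφ.contDiff_gradient.continuous.measurable.comp (by fun_prop)
  have h2 : Measurable fun p : ℝ × Ed d × Pm d => fderiv ℝ (gradient φ) p.2.1 :=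
    (hφ.contDiff_gradient.continuous_fderiv one_ne_zero).measurable.comp (by fun_prop)
  exact (hb.inner h1).add
    (((continuous_trace_comp d).measurable.comp (ha.prodMk h2)).const_mul (1 / 2))

lemma measurable_wInt {d : ℕ} {b : ℝ → Ed d → Pm d → Ed d}
    {a : ℝ → Ed d → Pm d → (Ed d →L[ℝ] Ed d)}
    (hb : Measurable fun p : ℝ × Ed d × Pm d => b p.1 p.2.1 p.2.2)
    (ha : Measurable fun p : ℝ × Ed d × Pm d => a p.1 p.2.1 p.2.2) :
    Measurable fun p : ℝ × Ed d × Pm d => ENNReal.ofReal (wInt b a p.1 p.2.1 p.2.2) := by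
  unfold wInt
  exact ((hb.norm.div (by fun_prop)).add (ha.norm.div (by fun_prop))).ennreal_ofReal

lemma wInt_nonneg {d : ℕ} (b : ℝ → Ed d → Pm d → Ed d)
    (a : ℝ → Ed d → Pm d → (Ed d →L[ℝ] Ed d)) (t : ℝ) (x : Ed d) (μ : Pm d) :
    0 ≤ wInt b a t x μ := by
  unfold wInt
  positivity

/-- A compactly supported continuous function is dominated by the inverse of any positive
continuous weight. -/
lemma exists_norm_le_div_of_hasCompactSupport {X E : Type*} [TopologicalSpace X]
    [NormedAddCommGroup E] [NormedSpace ℝ E] {f : X → E} (hf : Continuous f)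
    (hfc : HasCompactSupport f) {w : X → ℝ} (hw : Continuous w) (hpos : ∀ x, 0 < w x) :
    ∃ C : ℝ, 0 ≤ C ∧ ∀ x, ‖f x‖ ≤ C / w x := by
  obtain ⟨C, hC⟩ := (hw.smul hf).bounded_above_of_compact_support hfc.smul_left
  refine ⟨max C 0, le_max_right _ _, fun x => ?_⟩
  rw [le_div_iff₀ (hpos x), mul_comm]
  refine le_trans (le_of_eq ?_) ((hC x).trans (le_max_left _ _))
  rw [Pi.smul_apply', norm_smul, Real.norm_of_nonneg (hpos x).le]

/-- `L^μ_{b_t,a_t}φ` is dominated by the weighted integrand. -/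
lemma IsTestPhi.exists_abs_Lop_le {d : ℕ} {φ : Ed d → ℝ} (hφ : IsTestPhi φ) :
    ∃ C : ℝ, 0 ≤ C ∧ ∀ (b : ℝ → Ed d → Pm d → Ed d) (a : ℝ → Ed d → Pm d → (Ed d →L[ℝ] Ed d))
      (μ : Pm d) (t : ℝ) (x : Ed d), |Lop b a μ t φ x| ≤ C * wInt b a t x μ := by
  obtain ⟨C₁, h1, hC₁⟩ := exists_norm_le_div_of_hasCompactSupport
    hφ.contDiff_gradient.continuous hφ.hasCompactSupport_gradient
    (w := fun x : Ed d => 1 + ‖x‖) (by fun_prop) (fun x => by positivity)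
  obtain ⟨C₂, h2, hC₂⟩ := exists_norm_le_div_of_hasCompactSupport
    (hφ.contDiff_gradient.continuous_fderiv one_ne_zero)
    (hφ.hasCompactSupport_gradient.fderiv (𝕜 := ℝ))
    (w := fun x : Ed d => 1 + ‖x‖ ^ 2) (by fun_prop) (fun x => by positivity)
  obtain ⟨K, hK, hKb⟩ := exists_abs_trace_comp_le d
  refine ⟨C₁ + K * C₂, add_nonneg h1 (mul_nonneg hK h2), fun b a μ t x => ?_⟩
  have f1 : |⟪b t x μ, gradient φ x⟫| ≤ C₁ * (‖b t x μ‖ / (1 + ‖x‖)) := by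
    refine (abs_real_inner_le_norm _ _).trans ?_
    refine (mul_le_mul_of_nonneg_left (hC₁ x) (norm_nonneg _)).trans_eq ?_
    ring
  have f2 : |LinearMap.trace ℝ (Ed d) ((a t x μ ∘L fderiv ℝ (gradient φ) x).toLinearMap)| ≤
      K * C₂ * (‖a t x μ‖ / (1 + ‖x‖ ^ 2)) := by
    refine (hKb _ _).trans ?_
    refine (mul_le_mul_of_nonneg_left
      (mul_le_mul_of_nonneg_left (hC₂ x) (norm_nonneg _)) hK).trans_eq ?_
    ring
  unfold Lop wInt
  refine (abs_add_le _ _).trans ?_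
  rw [abs_mul, abs_of_nonneg (by norm_num : (0:ℝ) ≤ 1 / 2)]
  have p1 : 0 ≤ ‖b t x μ‖ / (1 + ‖x‖) := by positivity
  have p2 : 0 ≤ ‖a t x μ‖ / (1 + ‖x‖ ^ 2) := by positivity
  have p3 : 0 ≤ C₁ * (‖a t x μ‖ / (1 + ‖x‖ ^ 2)) := mul_nonneg h1 p2
  have p4 : 0 ≤ K * C₂ * (‖b t x μ‖ / (1 + ‖x‖)) := mul_nonneg (mul_nonneg hK h2) p1
  have p5 := abs_nonneg
    (LinearMap.trace ℝ (Ed d) ((a t x μ ∘L fderiv ℝ (gradient φ) x).toLinearMap))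
  rw [mul_add, add_mul, add_mul]
  linarith

lemma measurable_LPhi {d k : ℕ} {Φ : Fin k → Ed d → ℝ} (hΦ : ∀ i, IsTestPhi (Φ i)) :
    Measurable (LPhi Φ) := by
  refine measurable_pi_lambda _ fun i => ?_
  exact (measurable_integral_Pm (f := fun p => Φ i p.2.1)
    ((hΦ i).1.continuous.measurable.comp (by fun_prop))).comp
    (measurable_const (a := (0:ℝ)) |>.prodMk measurable_id)

lemma measurable_fderiv_LPhi {d k : ℕ} {Ψ : (Fin k → ℝ) → ℝ} (hΨ : ContDiff ℝ 1 Ψ)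
    {Φ : Fin k → Ed d → ℝ} (hΦ : ∀ i, IsTestPhi (Φ i)) (i : Fin k) :
    Measurable fun μ : Pm d => fderiv ℝ Ψ (LPhi Φ μ) (Pi.single i 1) :=
  ((hΨ.continuous_fderiv one_ne_zero).clm_apply continuous_const).measurable.comp
    (measurable_LPhi hΦ)

lemma measurable_Kba {d k : ℕ} {b : ℝ → Ed d → Pm d → Ed d}
    {a : ℝ → Ed d → Pm d → (Ed d →L[ℝ] Ed d)}
    (hb : Measurable fun p : ℝ × Ed d × Pm d => b p.1 p.2.1 p.2.2)
    (ha : Measurable fun p : ℝ × Ed d × Pm d => a p.1 p.2.1 p.2.2)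
    {Ψ : (Fin k → ℝ) → ℝ} (hΨ : ContDiff ℝ 1 Ψ)
    {Φ : Fin k → Ed d → ℝ} (hΦ : ∀ i, IsTestPhi (Φ i)) :
    Measurable fun p : ℝ × Ed d × Pm d => Kba b a p.1 Ψ Φ p.2.1 p.2.2 := by
  refine Finset.measurable_fun_sum _ fun i _ => ?_
  exact ((measurable_fderiv_LPhi hΨ hΦ i).comp (by fun_prop)).mul (measurable_Lop hb ha (hΦ i))

/-- `K_{b_t,a_t}F` is dominated by the weighted integrand. -/
lemma exists_abs_Kba_le {d k : ℕ} {Ψ : (Fin k → ℝ) → ℝ} (hΨ : ContDiff ℝ 1 Ψ)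
    (hΨc : HasCompactSupport Ψ) {Φ : Fin k → Ed d → ℝ} (hΦ : ∀ i, IsTestPhi (Φ i))
    (b : ℝ → Ed d → Pm d → Ed d) (a : ℝ → Ed d → Pm d → (Ed d →L[ℝ] Ed d)) :
    ∃ D : ℝ, 0 ≤ D ∧ ∀ t x μ, |Kba b a t Ψ Φ x μ| ≤ D * wInt b a t x μ := by
  choose C hC0 hC using fun i => (hΦ i).exists_abs_Lop_le
  obtain ⟨M, hM⟩ := (hΨ.continuous_fderiv one_ne_zero).bounded_above_of_compact_support
    (hΨc.fderiv (𝕜 := ℝ))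
  have hM0 : 0 ≤ M := (norm_nonneg _).trans (hM 0)
  refine ⟨∑ i, M * C i, Finset.sum_nonneg fun i _ => mul_nonneg hM0 (hC0 i), fun t x μ => ?_⟩
  refine (Finset.abs_sum_le_sum_abs _ _).trans ?_
  rw [Finset.sum_mul]
  refine Finset.sum_le_sum fun i _ => ?_
  rw [abs_mul, mul_assoc]
  refine mul_le_mul ?_ (hC i b a μ t x) (abs_nonneg _) hM0
  have h := (fderiv ℝ Ψ (LPhi Φ μ)).le_opNorm (Pi.single i 1)
  rw [Pi.norm_single, norm_one, mul_one] at h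
  exact h.trans (hM _)

lemma enorm_le_of_abs_le_wInt {d : ℕ} {b : ℝ → Ed d → Pm d → Ed d}
    {a : ℝ → Ed d → Pm d → (Ed d →L[ℝ] Ed d)} {D t : ℝ} (hD : 0 ≤ D) {μ : Pm d} {x : Ed d}
    {r : ℝ} (h : |r| ≤ D * wInt b a t x μ) :
    ‖r‖ₑ ≤ ENNReal.ofReal D * ENNReal.ofReal (wInt b a t x μ) := by
  rw [← ENNReal.ofReal_mul hD, ← ofReal_norm, Real.norm_eq_abs]
  exact ENNReal.ofReal_le_ofReal h

lemma lintegral_enorm_le_wInt {d : ℕ} {b : ℝ → Ed d → Pm d → Ed d}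
    {a : ℝ → Ed d → Pm d → (Ed d →L[ℝ] Ed d)} {D t : ℝ} (hD : 0 ≤ D) {μ : Pm d}
    {f : Ed d → ℝ} (h : ∀ x, |f x| ≤ D * wInt b a t x μ) :
    ∫⁻ x, ‖f x‖ₑ ∂(μ : Measure (Ed d)) ≤
      ENNReal.ofReal D * ∫⁻ x, ENNReal.ofReal (wInt b a t x μ) ∂(μ : Measure (Ed d)) := by
  rw [← lintegral_const_mul' _ _ ENNReal.ofReal_ne_top]
  exact lintegral_mono fun x => enorm_le_of_abs_le_wInt hD (h x)

lemma enorm_integral_le_wInt {d : ℕ} {b : ℝ → Ed d → Pm d → Ed d}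
    {a : ℝ → Ed d → Pm d → (Ed d →L[ℝ] Ed d)} {D t : ℝ} (hD : 0 ≤ D) {μ : Pm d}
    {f : Ed d → ℝ} (h : ∀ x, |f x| ≤ D * wInt b a t x μ) :
    ‖∫ x, f x ∂(μ : Measure (Ed d))‖ₑ ≤
      ENNReal.ofReal D * ∫⁻ x, ENNReal.ofReal (wInt b a t x μ) ∂(μ : Measure (Ed d)) :=
  (enorm_integral_le_lintegral_enorm _).trans (lintegral_enorm_le_wInt hD h)

/-- Along a solution of the Kolmogorov–Fokker–Planck equation, cylinder functions satisfy the
chain rule in weak form. -/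
lemma KFPmem.integral_deriv_mul_cylinder {T : ℝ} {d : ℕ} {hT : 0 ≤ T}
    {b : ℝ → Ed d → Pm d → Ed d} {a : ℝ → Ed d → Pm d → (Ed d →L[ℝ] Ed d)}
    (hb : Measurable fun p : ℝ × Ed d × Pm d => b p.1 p.2.1 p.2.2)
    (ha : Measurable fun p : ℝ × Ed d × Pm d => a p.1 p.2.1 p.2.2)
    {c : CurveSp T d} (hc : KFPmem hT b a c) {k : ℕ} {Ψ : (Fin k → ℝ) → ℝ}
    {Φ : Fin k → Ed d → ℝ} (hΨ : ContDiff ℝ 1 Ψ) (hΨc : HasCompactSupport Ψ)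
    (hΦ : ∀ i, IsTestPhi (Φ i)) {ξ : ℝ → ℝ} (hξ : IsTestXi T ξ) :
    ∫ t in (0:ℝ)..T, deriv ξ t * Ψ (LPhi Φ (c (projIcc 0 T hT t))) =
      - ∫ t in (0:ℝ)..T, ξ t * ∫ x, Kba b a t Ψ Φ x (c (projIcc 0 T hT t))
          ∂(c (projIcc 0 T hT t) : Measure (Ed d)) := by
  have hcm : Measurable fun t : ℝ => (t, c (projIcc 0 T hT t)) :=
    measurable_id.prodMk (c.continuous.comp continuous_projIcc).measurable
  have hW : Measurable fun t : ℝ => ∫⁻ x, ENNReal.ofReal (wInt b a t x (c (projIcc 0 T hT t)))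
      ∂(c (projIcc 0 T hT t) : Measure (Ed d)) :=
    (measurable_lintegral_Pm (measurable_wInt hb ha)).comp hcm
  have hfin := hc.1
  rw [← setLIntegral_congr Ioc_ae_eq_Icc] at hfin
  choose C hC0 hC using fun i => (hΦ i).exists_abs_Lop_le
  rw [weak_chain_rule hT hΨ hΨc (g := fun t => LPhi Φ (c (projIcc 0 T hT t)))
    (h := fun t i => ∫ x, Lop b a (c (projIcc 0 T hT t)) t (Φ i) x
      ∂(c (projIcc 0 T hT t) : Measure (Ed d))) ?_ ?_ (fun i ξ hξ => hc.2 ξ (Φ i) hξ (hΦ i)) hξ]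
  · congr 1
    refine intervalIntegral.integral_congr_ae ?_
    rw [uIoc_of_le hT, ← ae_restrict_iff' measurableSet_Ioc]
    filter_upwards [ae_lt_top hW hfin.ne] with t ht
    congr 1
    unfold Kba
    rw [integral_finsetSum]
    · exact Finset.sum_congr rfl fun i _ => (integral_const_mul _ _).symm
    · intro i _
      refine Integrable.const_mul ⟨?_, ?_⟩ _
      · exact ((measurable_Lop hb ha (hΦ i)).comp
          (g := fun p : ℝ × Ed d × Pm d => Lop b a p.2.2 p.1 (Φ i) p.2.1)
          (f := fun x => (t, x, c (projIcc 0 T hT t))) (by fun_prop)).aestronglyMeasurable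
      · exact (lintegral_enorm_le_wInt (hC0 i) (hC i b a _ t)).trans_lt
          (ENNReal.mul_lt_top ENNReal.ofReal_lt_top ht)
  · intro i
    have hm : Measurable fun t : ℝ => LPhi Φ (c (projIcc 0 T hT t)) i :=
      (measurable_pi_apply i).comp ((measurable_LPhi hΦ).comp (measurable_snd.comp hcm))
    obtain ⟨B, hB⟩ := (hΦ i).1.continuous.bounded_above_of_compact_support (hΦ i).2
    refine (intervalIntegrable_const (c := B)).mono_fun hm.aestronglyMeasurable
      (Filter.Eventually.of_forall fun t => ?_)
    refine (norm_integral_le_of_norm_le_const (Filter.Eventually.of_forall hB)).trans ?_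
    simpa using le_abs_self B
  · intro i
    rw [intervalIntegrable_iff_integrableOn_Ioc_of_le hT]
    refine ⟨((measurable_integral_Pm (measurable_Lop hb ha (hΦ i))).comp hcm
      ).aestronglyMeasurable, ?_⟩
    refine (lintegral_mono fun t => enorm_integral_le_wInt (hC0 i) (hC i b a _ t)).trans_lt ?_
    rw [lintegral_const_mul' _ _ ENNReal.ofReal_ne_top]
    exact ENNReal.mul_lt_top ENNReal.ofReal_lt_top hfin

lemma measurable_lintegral_wInt_eval {T : ℝ} {d : ℕ} (hT : 0 ≤ T)
    {b : ℝ → Ed d → Pm d → Ed d} {a : ℝ → Ed d → Pm d → (Ed d →L[ℝ] Ed d)}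
    (hb : Measurable fun p : ℝ × Ed d × Pm d => b p.1 p.2.1 p.2.2)
    (ha : Measurable fun p : ℝ × Ed d × Pm d => a p.1 p.2.1 p.2.2) :
    Measurable fun p : ℝ × CurveSp T d => ∫⁻ x,
      ENNReal.ofReal (wInt b a p.1 x (p.2 (projIcc 0 T hT p.1)))
      ∂(p.2 (projIcc 0 T hT p.1) : Measure (Ed d)) :=
  (measurable_lintegral_Pm (measurable_wInt hb ha)).comp
    (measurable_fst.prodMk (measurable_eval hT))

lemma integrable_integral_Kba {T : ℝ} {d : ℕ} (hT : 0 ≤ T)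
    {b : ℝ → Ed d → Pm d → Ed d} {a : ℝ → Ed d → Pm d → (Ed d →L[ℝ] Ed d)}
    (hb : Measurable fun p : ℝ × Ed d × Pm d => b p.1 p.2.1 p.2.2)
    (ha : Measurable fun p : ℝ × Ed d × Pm d => a p.1 p.2.1 p.2.2)
    (Λ : Measure (CurveSp T d)) [SFinite Λ]
    (hint : ∫⁻ c, ∫⁻ t in Set.Icc (0:ℝ) T, ∫⁻ x,
        ENNReal.ofReal (wInt b a t x (c (Set.projIcc 0 T hT t)))
        ∂(c (Set.projIcc 0 T hT t) : Measure (Ed d)) ∂volume ∂Λ < ∞)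
    {k : ℕ} {Ψ : (Fin k → ℝ) → ℝ} {Φ : Fin k → Ed d → ℝ} (hΨ : ContDiff ℝ 1 Ψ)
    (hΨc : HasCompactSupport Ψ) (hΦ : ∀ i, IsTestPhi (Φ i)) :
    Integrable (fun p : ℝ × CurveSp T d =>
      ∫ x, Kba b a p.1 Ψ Φ x (p.2 (projIcc 0 T hT p.1))
        ∂(p.2 (projIcc 0 T hT p.1) : Measure (Ed d))) ((volume.restrict (Ioc 0 T)).prod Λ) := by
  have hpair : Measurable fun p : ℝ × CurveSp T d => (p.1, p.2 (projIcc 0 T hT p.1)) :=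
    measurable_fst.prodMk (measurable_eval hT)
  obtain ⟨D, hD0, hD⟩ := exists_abs_Kba_le hΨ hΨc hΦ b a
  refine ⟨((measurable_integral_Pm (measurable_Kba hb ha hΨ hΦ)).comp hpair
    ).aestronglyMeasurable, ?_⟩
  have hle : ∀ p : ℝ × CurveSp T d, ‖∫ x, Kba b a p.1 Ψ Φ x (p.2 (projIcc 0 T hT p.1))
        ∂(p.2 (projIcc 0 T hT p.1) : Measure (Ed d))‖ₑ ≤
      ENNReal.ofReal D * ∫⁻ x, ENNReal.ofReal (wInt b a p.1 x (p.2 (projIcc 0 T hT p.1)))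
        ∂(p.2 (projIcc 0 T hT p.1) : Measure (Ed d)) := fun p =>
    enorm_integral_le_wInt hD0 fun x => hD p.1 x (p.2 (projIcc 0 T hT p.1))
  rw [hasFiniteIntegral_iff_enorm]
  refine (lintegral_mono hle).trans_lt ?_
  rw [lintegral_const_mul' _ _ ENNReal.ofReal_ne_top]
  refine ENNReal.mul_lt_top ENNReal.ofReal_lt_top ?_
  rw [lintegral_prod_symm _ (measurable_lintegral_wInt_eval hT hb ha).aemeasurable]
  simpa only [setLIntegral_congr Ioc_ae_eq_Icc] using hint

/-- If `Λ ∈ P(C([0,T],P(ℝ^d)))` is concentrated on `KFP(b,a)` and has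
finite weighted integrability, then the curve of random measures `M_t := (e_t)_#Λ`
satisfies the weighted integrability and solves `∂_t M_t = K^*_{b_t,a_t} M_t`:
for all cylinder functions `F = Ψ∘L_Φ ∈ Cyl_c^{1,2}(P(ℝ^d))` and `ξ ∈ C_c^1(0,T)`,
`∫_0^T ξ'(t)∫F dM_t dt = −∫_0^T ξ(t)∫∫ K_{b_t,a_t}F(x,μ) dμ dM_t dt`. -/
theorem stmt12 {T : ℝ} {d : ℕ} (hT : 0 ≤ T)
    (b : ℝ → Ed d → Pm d → Ed d)
    (a : ℝ → Ed d → Pm d → (Ed d →L[ℝ] Ed d))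
    (hb : Measurable fun p : ℝ × Ed d × Pm d => b p.1 p.2.1 p.2.2)
    (ha : Measurable fun p : ℝ × Ed d × Pm d => a p.1 p.2.1 p.2.2)
    (Λ : Measure (CurveSp T d)) [IsProbabilityMeasure Λ]
    (hconc : ∀ᵐ c ∂Λ, KFPmem hT b a c)
    (hint : ∫⁻ c, ∫⁻ t in Set.Icc (0:ℝ) T, ∫⁻ x,
        ENNReal.ofReal (wInt b a t x (c (Set.projIcc 0 T hT t)))
        ∂(c (Set.projIcc 0 T hT t) : Measure (Ed d)) ∂volume ∂Λ < ∞) :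
    (∫⁻ t in Set.Icc (0:ℝ) T, ∫⁻ μ, ∫⁻ x,
        ENNReal.ofReal (wInt b a t x μ) ∂(μ : Measure (Ed d))
        ∂(Λ.map (fun c : CurveSp T d => c (Set.projIcc 0 T hT t))) ∂volume) < ∞ ∧
    (∀ (k : ℕ) (Ψ : (Fin k → ℝ) → ℝ) (Φ : Fin k → Ed d → ℝ),
      ContDiff ℝ 1 Ψ → HasCompactSupport Ψ → (∀ i, IsTestPhi (Φ i)) →
      ∀ ξ, IsTestXi T ξ →
      ∫ t in (0:ℝ)..T, deriv ξ t *
          ∫ μ, Ψ (LPhi Φ μ)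
            ∂(Λ.map (fun c : CurveSp T d => c (Set.projIcc 0 T hT t))) =
        - ∫ t in (0:ℝ)..T, ξ t *
            ∫ μ, (∫ x, Kba b a t Ψ Φ x μ ∂(μ : Measure (Ed d)))
              ∂(Λ.map (fun c : CurveSp T d => c (Set.projIcc 0 T hT t)))) := by
  have hev : ∀ t, Measurable fun c : CurveSp T d => c (projIcc 0 T hT t) := fun t =>
    (measurable_eval hT).comp measurable_prodMk_left
  have hW := measurable_lintegral_Pm (measurable_wInt hb ha)
  refine ⟨?_, fun k Ψ Φ hΨ hΨc hΦ ξ hξ => ?_⟩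
  · rw [lintegral_lintegral_swap (f := fun (c : CurveSp T d) (t : ℝ) => ∫⁻ x,
      ENNReal.ofReal (wInt b a t x (c (projIcc 0 T hT t)))
      ∂(c (projIcc 0 T hT t) : Measure (Ed d)))
      ((measurable_lintegral_wInt_eval hT hb ha).comp measurable_swap).aemeasurable] at hint
    refine lt_of_eq_of_lt (lintegral_congr fun t => ?_) hint
    exact lintegral_map (hW.comp measurable_prodMk_left) (hev t)
  have hK := measurable_integral_Pm (measurable_Kba hb ha hΨ hΦ)
  have hF : Measurable fun μ : Pm d => Ψ (LPhi Φ μ) :=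
    hΨ.continuous.measurable.comp (measurable_LPhi hΦ)
  have hmapF : ∀ t, deriv ξ t * ∫ μ, Ψ (LPhi Φ μ)
        ∂(Λ.map fun c : CurveSp T d => c (projIcc 0 T hT t)) =
      ∫ c, deriv ξ t * Ψ (LPhi Φ (c (projIcc 0 T hT t))) ∂Λ := fun t => by
    rw [integral_map (hev t).aemeasurable hF.aestronglyMeasurable, integral_const_mul]
  have hmapK : ∀ t, ξ t * ∫ μ, (∫ x, Kba b a t Ψ Φ x μ ∂(μ : Measure (Ed d)))
        ∂(Λ.map fun c : CurveSp T d => c (projIcc 0 T hT t)) =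
      ∫ c, ξ t * (∫ x, Kba b a t Ψ Φ x (c (projIcc 0 T hT t))
        ∂(c (projIcc 0 T hT t) : Measure (Ed d))) ∂Λ := fun t => by
    rw [integral_const_mul]
    exact congrArg (ξ t * ·) (integral_map (hev t).aemeasurable
      (hK.comp measurable_prodMk_left).aestronglyMeasurable)
  simp_rw [hmapF, hmapK, intervalIntegral.integral_of_le hT]
  have hξ'c : Continuous (deriv ξ) := hξ.1.continuous_deriv le_rfl
  obtain ⟨X, hX⟩ := hξ.1.continuous.bounded_above_of_compact_support hξ.2.1
  obtain ⟨X', hX'⟩ := hξ'c.bounded_above_of_compact_support hξ.2.1.deriv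
  obtain ⟨B, hB⟩ := hΨ.continuous.bounded_above_of_compact_support hΨc
  have hintF : Integrable (Function.uncurry fun (t : ℝ) (c : CurveSp T d) =>
      deriv ξ t * Ψ (LPhi Φ (c (projIcc 0 T hT t)))) ((volume.restrict (Ioc 0 T)).prod Λ) := by
    refine Integrable.of_bound (C := X' * B) ?_ (Filter.Eventually.of_forall fun p => ?_)
    · exact ((hξ'c.measurable.comp measurable_fst).mul
        (hF.comp (measurable_eval hT))).aestronglyMeasurable
    · exact (norm_mul_le _ _).trans
        (mul_le_mul (hX' _) (hB _) (norm_nonneg _) ((norm_nonneg _).trans (hX' 0)))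
  have hintK : Integrable (Function.uncurry fun (t : ℝ) (c : CurveSp T d) =>
      ξ t * ∫ x, Kba b a t Ψ Φ x (c (projIcc 0 T hT t))
        ∂(c (projIcc 0 T hT t) : Measure (Ed d))) ((volume.restrict (Ioc 0 T)).prod Λ) := by
    exact (integrable_integral_Kba hT hb ha Λ hint hΨ hΨc hΦ).bdd_mul (c := X)
      (hξ.1.continuous.measurable.comp measurable_fst).aestronglyMeasurable
      (Filter.Eventually.of_forall fun p => hX _)
  rw [integral_integral_swap hintF, integral_integral_swap hintK, ← integral_neg]
  refine integral_congr_ae ?_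
  filter_upwards [hconc] with c hc
  simpa only [intervalIntegral.integral_of_le hT] using
    hc.integral_deriv_mul_cylinder hb ha hΨ hΨc hΦ hξ
end
end
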